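/- Let V ⊂ ℙⁿ be a hypersurface of degree d and p ∈ V. Then either n ≤ μ_p(V) ≤ d, or there is a line through p contained in V. In particular, every hypersurface in ℙⁿ of degree at most n−1 is ruled (through every point there passes a line contained in V). -/

import Mathlib

/-!
STATEMENT 7: For a hypersurface `V = Z(f) ⊂ ℙⁿ` of degree `d` and `p ∈ V`, either
`n ≤ μ_p(V) ≤ d`, or there is a line through `p` contained in `V`.  In particular,
every hypersurface of degree at most `n−1` is ruled: through every point of it there
passes a line contained in it.

Conventions: nonzero representatives in `K^{n+1}`; a line through `p` is given by a
nonzero `q` not proportional to `p`; it is contained in `V` iff `f(p + t q) = 0`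
identically; `μ_p(V)` (`oscOrder`) is the supremum of the orders of contact.
-/

open MvPolynomial Polynomial
open scoped Classical

/-- The `k`-th directional Taylor coefficient `f_k(x,y)`, characterized by
`f(x + t y) = Σ_k f_k(x,y) t^k / k!`. -/
noncomputable def dirCoeff {K : Type} [CommRing K] {n : ℕ}
    (f : MvPolynomial (Fin (n + 1)) K) (k : ℕ) :
    MvPolynomial (Fin (n + 1) ⊕ Fin (n + 1)) K :=
  (k.factorial : MvPolynomial (Fin (n + 1) ⊕ Fin (n + 1)) K) *
    (Polynomial.coeff
      (MvPolynomial.aeval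
        (fun i => Polynomial.C (MvPolynomial.X (Sum.inl i)) +
          Polynomial.X * Polynomial.C (MvPolynomial.X (Sum.inr i))) f) k)

/-- The restriction of `f` to the line `t ↦ p + t q`. -/
noncomputable def linePoly {K : Type} [CommRing K] {n : ℕ}
    (f : MvPolynomial (Fin (n + 1)) K) (p q : Fin (n + 1) → K) : Polynomial K :=
  MvPolynomial.aeval (fun i => Polynomial.C (p i) + Polynomial.X * Polynomial.C (q i)) f

/-- Order of contact at `p` of the line through `p` and `q` with `Z(f)`. -/
noncomputable def contactOrder {K : Type} [Field K] {n : ℕ}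
    (f : MvPolynomial (Fin (n + 1)) K) (p q : Fin (n + 1) → K) : ℕ∞ :=
  if linePoly f p q = 0 then ⊤ else ((linePoly f p q).rootMultiplicity 0 : ℕ∞)

/-- The order of osculation `μ_p(V)`: supremum of orders of contact over the lines
through `p` (represented by nonzero `q` not proportional to `p`). -/
noncomputable def oscOrder {K : Type} [Field K] {n : ℕ}
    (f : MvPolynomial (Fin (n + 1)) K) (p : Fin (n + 1) → K) : ℕ∞ :=
  ⨆ q : {q : Fin (n + 1) → K // q ≠ 0 ∧ ¬∃ c : K, q = c • p},
    contactOrder f p (q : Fin (n + 1) → K)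

/-- The condition `Z_p^k = {p}`. -/
def ZpkTrivial {K : Type} [Field K] {n : ℕ}
    (f : MvPolynomial (Fin (n + 1)) K) (p : Fin (n + 1) → K) (k : ℕ) : Prop :=
  ∀ q : Fin (n + 1) → K, q ≠ 0 →
    (∀ j, 1 ≤ j → j ≤ k → MvPolynomial.eval (Sum.elim p q) (dirCoeff f j) = 0) →
      ∃ c : K, q = c • p

/-- The ideal of polynomials vanishing at the origin has height the number of variables. -/
lemma height_vanishingIdeal_zero (K : Type) [Field K] [IsAlgClosed K] (m : ℕ) :
    (MvPolynomial.vanishingIdeal K {(0 : Fin m → K)} : Ideal (MvPolynomial (Fin m) K)).height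
      = m := by
  have hdim : ringKrullDim (MvPolynomial (Fin m) K) = m := by simp
  have : FiniteRingKrullDim (MvPolynomial (Fin m) K) := by
    rw [finiteRingKrullDim_iff_ne_bot_and_top, hdim]
    exact ⟨by simp, WithBot.coe_inj.not.mpr (ENat.natCast_ne_top m)⟩
  obtain ⟨M, hM, hMh⟩ := Ideal.exists_isMaximal_height (R := MvPolynomial (Fin m) K)
  obtain ⟨x, rfl⟩ := MvPolynomial.isMaximal_iff_eq_vanishingIdeal_singleton.mp hM
  let e : MvPolynomial (Fin m) K ≃ₐ[K] MvPolynomial (Fin m) K :=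
    AlgEquiv.ofAlgHom
      (MvPolynomial.aeval fun i => MvPolynomial.X i - MvPolynomial.C (x i))
      (MvPolynomial.aeval fun i => MvPolynomial.X i + MvPolynomial.C (x i))
      (by ext i : 1; simp [MvPolynomial.algHom_C]) (by ext i : 1; simp [MvPolynomial.algHom_C])
  have hcomap : (MvPolynomial.vanishingIdeal K {x} : Ideal (MvPolynomial (Fin m) K)).comap
      (e : MvPolynomial (Fin m) K ≃+* MvPolynomial (Fin m) K) =
      MvPolynomial.vanishingIdeal K {(0 : Fin m → K)} := by
    ext g
    rw [Ideal.mem_comap, MvPolynomial.mem_vanishingIdeal_singleton_iff,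
      MvPolynomial.mem_vanishingIdeal_singleton_iff]
    have : (MvPolynomial.aeval x).comp (e : MvPolynomial (Fin m) K →ₐ[K] _) =
        MvPolynomial.aeval (0 : Fin m → K) := by
      ext i; simp [e]
    rw [← this]
    rfl
  rw [hdim] at hMh
  rw [← hcomap, RingEquiv.height_comap]
  exact_mod_cast hMh

/-- Fewer than `m` polynomials in `m` variables which vanish at the origin have a common zero
away from the origin. -/
lemma exists_ne_zero_common_zero {K : Type} [Field K] [IsAlgClosed K] {m : ℕ}
    (s : Finset (MvPolynomial (Fin m) K)) (hs : s.card < m)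
    (h0 : ∀ g ∈ s, MvPolynomial.eval 0 g = 0) :
    ∃ q : Fin m → K, q ≠ 0 ∧ ∀ g ∈ s, MvPolynomial.eval q g = 0 := by
  by_contra! hcon
  have hZ : MvPolynomial.zeroLocus K (Ideal.span (s : Set (MvPolynomial (Fin m) K))) = {0} := by
    rw [MvPolynomial.zeroLocus_span]
    ext q
    simp only [MvPolynomial.aeval_eq_eval, Set.mem_ofPred_eq,
      Set.mem_singleton_iff]
    refine ⟨fun h => ?_, fun h => h ▸ h0⟩
    by_contra hq
    obtain ⟨g, hg, hgq⟩ := hcon q hq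
    exact hgq (h g hg)
  have hrad := MvPolynomial.vanishingIdeal_zeroLocus_eq_radical (K := K)
    (Ideal.span (s : Set (MvPolynomial (Fin m) K)))
  rw [hZ] at hrad
  have hmin : MvPolynomial.vanishingIdeal K {(0 : Fin m → K)} ∈
      (Ideal.span (s : Set (MvPolynomial (Fin m) K))).minimalPrimes := by
    rw [← Ideal.radical_minimalPrimes, ← hrad, Ideal.minimalPrimes_eq_subsingleton_self]
    rfl
  have := Ideal.height_le_card_of_mem_minimalPrimes_span_finset hmin
  rw [height_vanishingIdeal_zero] at this
  exact absurd (by exact_mod_cast this) hs.not_ge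

/-- The coefficients of `linePoly f p q`, as polynomials in `q`. -/
noncomputable def lineCoeff {K : Type} [Field K] {n : ℕ} (f : MvPolynomial (Fin (n + 1)) K)
    (p : Fin (n + 1) → K) (k : ℕ) : MvPolynomial (Fin (n + 1)) K :=
  (MvPolynomial.aeval (fun i => Polynomial.C (MvPolynomial.C (p i)) +
    Polynomial.X * Polynomial.C (MvPolynomial.X i)) f :
      Polynomial (MvPolynomial (Fin (n + 1)) K)).coeff k

lemma eval_lineCoeff {K : Type} [Field K] {n : ℕ} (f : MvPolynomial (Fin (n + 1)) K)
    (p q : Fin (n + 1) → K) (k : ℕ) :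
    MvPolynomial.eval q (lineCoeff f p k) = (linePoly f p q).coeff k := by
  have : (Polynomial.mapAlgHom (MvPolynomial.aeval (R := K) q)).comp
      (MvPolynomial.aeval (fun i => Polynomial.C (MvPolynomial.C (p i)) +
        Polynomial.X * Polynomial.C (MvPolynomial.X i))) =
      MvPolynomial.aeval (fun i => Polynomial.C (p i) + Polynomial.X * Polynomial.C (q i)) := by
    ext i : 1
    simp
  rw [linePoly, ← this, lineCoeff]
  simp [Polynomial.coeff_map]

lemma linePoly_zero_right {K : Type} [Field K] {n : ℕ} (f : MvPolynomial (Fin (n + 1)) K)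
    (p : Fin (n + 1) → K) : linePoly f p 0 = Polynomial.C (MvPolynomial.eval p f) := by
  have : (Polynomial.CAlgHom (R := K)).comp (MvPolynomial.aeval p) =
      MvPolynomial.aeval (fun i => Polynomial.C (p i) + Polynomial.X * Polynomial.C 0) := by
    ext i : 1
    simp
  exact (DFunLike.congr_fun this f).symm

lemma coeff_zero_linePoly {K : Type} [Field K] {n : ℕ} (f : MvPolynomial (Fin (n + 1)) K)
    (p q : Fin (n + 1) → K) : (linePoly f p q).coeff 0 = MvPolynomial.eval p f := by
  have : (Polynomial.aeval (R := K) (0 : K)).comp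
      (MvPolynomial.aeval (fun i => Polynomial.C (p i) + Polynomial.X * Polynomial.C (q i))) =
      MvPolynomial.aeval p := by
    ext i : 1
    simp
  rw [Polynomial.coeff_zero_eq_eval_zero]
  exact DFunLike.congr_fun this f

lemma natDegree_linePoly_le {K : Type} [Field K] {n d : ℕ} {f : MvPolynomial (Fin (n + 1)) K}
    (hf : f.totalDegree ≤ d) (p q : Fin (n + 1) → K) : (linePoly f p q).natDegree ≤ d := by
  have h := MvPolynomial.aeval_natDegree_le (n := 1) f hf
    (fun i => Polynomial.C (p i) + Polynomial.X * Polynomial.C (q i)) fun i => by compute_degree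
  simpa [linePoly] using h

/-- Through every point of `Z(f)` there is a line with contact of order at least `n`. -/
lemma exists_X_pow_dvd_linePoly {K : Type} [Field K] [IsAlgClosed K] {n : ℕ} (hn : 1 ≤ n)
    (f : MvPolynomial (Fin (n + 1)) K) {p : Fin (n + 1) → K} (hp : p ≠ 0)
    (hpV : MvPolynomial.eval p f = 0) :
    ∃ q : Fin (n + 1) → K, q ≠ 0 ∧ (¬∃ c : K, q = c • p) ∧ Polynomial.X ^ n ∣ linePoly f p q := by
  obtain ⟨i, hi⟩ := Function.ne_iff.mp hp
  let s : Finset (MvPolynomial (Fin (n + 1)) K) :=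
    insert (MvPolynomial.X i) ((Finset.Ico 1 n).image (lineCoeff f p))
  have hs : s.card < n + 1 := by
    have h₁ := Finset.card_insert_le (MvPolynomial.X i) ((Finset.Ico 1 n).image (lineCoeff f p))
    have h₂ : ((Finset.Ico 1 n).image (lineCoeff f p)).card ≤ n - 1 :=
      Finset.card_image_le.trans (by simp)
    grind
  obtain ⟨q, hq, hqs⟩ := exists_ne_zero_common_zero s hs fun g hg => by
    rcases Finset.mem_insert.mp hg with rfl | hg
    · simp
    · obtain ⟨k, hk, rfl⟩ := Finset.mem_image.mp hg
      rw [eval_lineCoeff, linePoly_zero_right, hpV]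
      simp
  have hqi : q i = 0 := by simpa using hqs _ (Finset.mem_insert_self _ _)
  refine ⟨q, hq, ?_, Polynomial.X_pow_dvd_iff.mpr fun k hk => ?_⟩
  · rintro ⟨c, rfl⟩
    have hc : c = 0 := (mul_eq_zero.mp hqi).resolve_right hi
    simp [hc] at hq
  · rcases k.eq_zero_or_pos with rfl | hk0
    · rw [coeff_zero_linePoly, hpV]
    · rw [← eval_lineCoeff]
      exact hqs _ (Finset.mem_insert_of_mem
        (Finset.mem_image_of_mem _ (Finset.mem_Ico.mpr ⟨hk0, hk⟩)))

lemma oscOrder_bounds_or_exists_line {K : Type} [Field K] [IsAlgClosed K] {n d : ℕ} (hn : 1 ≤ n)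
    {f : MvPolynomial (Fin (n + 1)) K} (hf : f.totalDegree ≤ d)
    {p : Fin (n + 1) → K} (hp : p ≠ 0) (hpV : MvPolynomial.eval p f = 0) :
    ((n : ℕ∞) ≤ oscOrder f p ∧ oscOrder f p ≤ (d : ℕ∞)) ∨
      ∃ q : Fin (n + 1) → K, q ≠ 0 ∧ (¬∃ c : K, q = c • p) ∧ linePoly f p q = 0 := by
  refine or_iff_not_imp_right.mpr fun hline => ?_
  push Not at hline
  constructor
  · obtain ⟨q, hq, hqp, hdvd⟩ := exists_X_pow_dvd_linePoly hn f hp hpV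
    have h0 := hline q hq (not_exists.mp hqp)
    refine le_trans ?_ (le_iSup _ ⟨q, hq, hqp⟩)
    rw [contactOrder, if_neg h0, Nat.cast_le, Polynomial.le_rootMultiplicity_iff h0]
    simpa using hdvd
  · refine iSup_le fun ⟨q, hq, hqp⟩ => ?_
    have h0 := hline q hq (not_exists.mp hqp)
    rw [contactOrder, if_neg h0, Nat.cast_le, ← Polynomial.count_roots]
    exact (Multiset.count_le_card _ _).trans
      ((Polynomial.card_roots' _).trans (natDegree_linePoly_le hf p q))

theorem oscOrder_bounds_or_line_in_V
    (K : Type) [Field K] [IsAlgClosed K] [CharZero K] (n d : ℕ) (hn : 1 ≤ n)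
    (f : MvPolynomial (Fin (n + 1)) K) (hf : f.IsHomogeneous d) (hsf : Squarefree f)
    (p : Fin (n + 1) → K) (hp : p ≠ 0) (hpV : MvPolynomial.eval p f = 0) :
    (((n : ℕ∞) ≤ oscOrder f p ∧ oscOrder f p ≤ (d : ℕ∞)) ∨
      ∃ q : Fin (n + 1) → K, q ≠ 0 ∧ (¬∃ c : K, q = c • p) ∧ linePoly f p q = 0) ∧
    (d ≤ n - 1 →
      ∀ p' : Fin (n + 1) → K, p' ≠ 0 → MvPolynomial.eval p' f = 0 →
        ∃ q : Fin (n + 1) → K, q ≠ 0 ∧ (¬∃ c : K, q = c • p') ∧ linePoly f p' q = 0) := by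
  refine ⟨oscOrder_bounds_or_exists_line hn hf.totalDegree_le hp hpV, fun hd p' hp' hpV' => ?_⟩
  refine (oscOrder_bounds_or_exists_line hn hf.totalDegree_le hp' hpV').resolve_left fun h => ?_
  have hnd : n ≤ d := by exact_mod_cast h.1.trans h.2
  omega
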